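/- Let D ⊂ ℝᵈ be measurable with finite measure and let Φ(x) = Σ_{m∈ℤᵈ} χ_D(x+m). Then the exponential system E(ℤᵈ) = {e^{2πi n·x}}_{n∈ℤᵈ} is a Riesz sequence in L²(D) if and only if there exist constants 0 < A ≤ B < ∞ such that A ≤ Φ(x) ≤ B for almost every x in the unit cube [-1/2,1/2]ᵈ. -/

import Mathlib

open MeasureTheory Real Set
open scoped ENNReal

noncomputable section

/-- The exponential `e^{2πi n·x}` on `ℝᵈ`. -/
def fExp (d : ℕ) (n : Fin d → ℤ) (x : Fin d → ℝ) : ℂ :=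
  Complex.exp (2 * Real.pi * Complex.I * (∑ i, (n i : ℝ) * x i))

/-- The unit cube `[-1/2, 1/2]ᵈ`. -/
def unitCube (d : ℕ) : Set (Fin d → ℝ) :=
  Set.univ.pi fun _ => Set.Icc (-(1 / 2) : ℝ) (1 / 2)

/-- `Φ(x) = Σ_{m ∈ ℤᵈ} χ_D(x + m)`, valued in `ℝ≥0∞`. -/
def Phi (d : ℕ) (D : Set (Fin d → ℝ)) (x : Fin d → ℝ) : ℝ≥0∞ :=
  ∑' m : Fin d → ℤ, D.indicator (fun _ => (1 : ℝ≥0∞)) (x + fun i => (m i : ℝ))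

/-- `E(ℤᵈ)` is a Riesz sequence in `L²(D)` with constants `A ≤ B`. -/
def RieszSeq (d : ℕ) (D : Set (Fin d → ℝ)) (A B : ℝ) : Prop :=
  ∀ a : (Fin d → ℤ) →₀ ℂ,
    A * ∑ n ∈ a.support, ‖a n‖ ^ 2
        ≤ ∫ x in D, ‖∑ n ∈ a.support, a n * fExp d n x‖ ^ 2 ∧
    ∫ x in D, ‖∑ n ∈ a.support, a n * fExp d n x‖ ^ 2
        ≤ B * ∑ n ∈ a.support, ‖a n‖ ^ 2


def Qd (d : ℕ) : Set (Fin d → ℝ) := Set.univ.pi fun _ => Set.Ioc (-(1 / 2) : ℝ) (1 / 2)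

def pr (d : ℕ) (x : Fin d → ℝ) : UnitAddTorus (Fin d) := fun i => (x i : UnitAddCircle)

def sec (d : ℕ) (t : UnitAddTorus (Fin d)) : Fin d → ℝ :=
  fun i => (AddCircle.measurableEquivIoc 1 (-(1 / 2) : ℝ) (t i) : ℝ)

lemma measurable_pr (d : ℕ) : Measurable (pr d) :=
  measurable_pi_lambda _ fun i => AddCircle.measurable_mk'.comp (measurable_pi_apply i)

lemma measurable_sec (d : ℕ) : Measurable (sec d) :=
  measurable_pi_lambda _ fun i => measurable_subtype_coe.comp
    ((AddCircle.measurableEquivIoc 1 (-(1 / 2) : ℝ)).measurable.comp (measurable_pi_apply i))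

lemma measurableSet_Qd (d : ℕ) : MeasurableSet (Qd d) :=
  MeasurableSet.univ_pi fun _ => measurableSet_Ioc

lemma sec_pr (d : ℕ) (x : Fin d → ℝ) (hx : x ∈ Qd d) : sec d (pr d x) = x := by
  funext i
  have h := hx i (mem_univ i)
  have h' : x i ∈ Ioc (-(1/2) : ℝ) (-(1/2) + 1) := ⟨h.1, by linarith [h.2]⟩
  have := (AddCircle.measurableEquivIoc 1 (-(1 / 2) : ℝ)).apply_symm_apply ⟨x i, h'⟩
  exact congrArg Subtype.val this

lemma pr_add (d : ℕ) (x : Fin d → ℝ) (m : Fin d → ℤ) :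
    pr d (x + fun i => (m i : ℝ)) = pr d x := by
  funext i
  simp only [pr, Pi.add_apply, AddCircle.coe_add]
  have : (((m i : ℤ) : ℝ) : UnitAddCircle) = 0 := by
    rw [AddCircle.coe_eq_zero_iff]
    exact ⟨m i, by simp⟩
  rw [this, add_zero]

lemma volume_Qd_ne_top (d : ℕ) : volume (Qd d) ≠ ⊤ := by
  rw [Qd, volume_pi_pi]
  simp

instance (d : ℕ) : IsFiniteMeasure (volume.restrict (Qd d)) :=
  ⟨by simpa using (volume_Qd_ne_top d).lt_top⟩

lemma restrict_unitCube (d : ℕ) :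
    (volume : Measure (Fin d → ℝ)).restrict (unitCube d) = volume.restrict (Qd d) := by
  apply Measure.restrict_congr_set
  have := Measure.univ_pi_Ioc_ae_eq_Icc (μ := fun _ : Fin d => (volume : Measure ℝ))
    (f := fun _ => (-(1/2) : ℝ)) (g := fun _ => (1/2 : ℝ))
  rw [← Set.pi_univ_Icc] at this
  exact this.symm

lemma lintegral_tile (d : ℕ) (f : (Fin d → ℝ) → ℝ≥0∞) (hf : Measurable f) :
    ∫⁻ x, f x = ∫⁻ x in Qd d, ∑' m : Fin d → ℤ, f (x + fun i => (m i : ℝ)) := by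
  have ht : ∀ m : Fin d → ℤ, AEMeasurable (fun x => f (x + fun i => (m i : ℝ)))
      (volume.restrict (Qd d)) := fun m => (hf.comp (measurable_add_const _)).aemeasurable
  rw [lintegral_tsum ht]
  let s : (Fin d → ℤ) → Set (Fin d → ℝ) := fun m => {x | (x - fun i => (m i : ℝ)) ∈ Qd d}
  have hs : ∀ m, MeasurableSet (s m) := fun m =>
    (measurable_id.sub_const _) (measurableSet_Qd d)
  have hk : ∀ m x, x ∈ s m → ∀ i, m i = ⌈x i - 1/2⌉ := by
    intro m x hx i
    have h := hx i (mem_univ i)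
    simp only [Pi.sub_apply, mem_Ioc] at h
    symm
    rw [Int.ceil_eq_iff]
    constructor <;> linarith [h.1, h.2]
  have hd : Pairwise (Function.onFun Disjoint s) := by
    intro m n hmn
    refine Set.disjoint_left.2 fun x hx hy => hmn ?_
    funext i
    rw [hk m x hx i, hk n x hy i]
  have hU : (⋃ m, s m) = univ := by
    refine eq_univ_of_forall fun x => mem_iUnion.2 ⟨fun i => ⌈x i - 1/2⌉, fun i _ => ?_⟩
    simp only [Pi.sub_apply, mem_Ioc]
    have h1 := Int.le_ceil (x i - 1/2)
    have h2 := Int.ceil_lt_add_one (x i - 1/2)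
    constructor <;> linarith
  rw [← setLIntegral_univ, ← hU, lintegral_iUnion hs hd]
  congr 1
  funext m
  have := (measurePreserving_add_right (volume : Measure (Fin d → ℝ))
    (fun i => (m i : ℝ))).setLIntegral_comp_preimage (hs m) hf
  rw [← this]
  congr 2
  ext x
  simp [s]

lemma measurable_Phi (d : ℕ) (D : Set (Fin d → ℝ)) (hD : MeasurableSet D) :
    Measurable (Phi d D) :=
  Measurable.ennreal_tsum fun _ =>
    (measurable_const.indicator hD).comp (measurable_add_const _)

lemma map_D (d : ℕ) (D : Set (Fin d → ℝ)) (hD : MeasurableSet D) :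
    (volume.restrict D).map (pr d) = ((volume.restrict (Qd d)).withDensity (Phi d D)).map (pr d) := by
  ext E hE
  have hE' := measurable_pr d hE
  rw [Measure.map_apply (measurable_pr d) hE, Measure.map_apply (measurable_pr d) hE,
    Measure.restrict_apply hE', withDensity_apply _ hE', ← lintegral_indicator_one (hE'.inter hD),
    lintegral_tile d _ (measurable_one.indicator (hE'.inter hD)), ← lintegral_indicator hE']
  congr 1
  funext x
  by_cases hx : x ∈ pr d ⁻¹' E
  · rw [indicator_of_mem hx, Phi]
    congr 1
    funext m
    have hx' : (x + fun i => (m i : ℝ)) ∈ pr d ⁻¹' E := by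
      rw [mem_preimage, pr_add]; exact hx
    by_cases h : (x + fun i => (m i : ℝ)) ∈ D
    · have h2 : (x + fun i => (m i : ℝ)) ∈ pr d ⁻¹' E ∩ D := ⟨hx', h⟩
      rw [indicator_of_mem h, indicator_of_mem h2]; rfl
    · rw [indicator_of_notMem h, indicator_of_notMem (fun h' => h h'.2)]
  · rw [indicator_of_notMem hx]
    rw [ENNReal.tsum_eq_zero]
    intro m
    refine indicator_of_notMem (fun h' => hx ?_) _
    have := h'.1
    rwa [mem_preimage, pr_add] at this

lemma map_sec_pr (d : ℕ) (μ : Measure (Fin d → ℝ)) (hμ : ∀ᵐ x ∂μ, x ∈ Qd d) :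
    (μ.map (pr d)).map (sec d) = μ := by
  rw [Measure.map_map (measurable_sec d) (measurable_pr d)]
  have : (sec d ∘ pr d) =ᵐ[μ] id := by
    filter_upwards [hμ] with x hx using sec_pr d x hx
  rw [Measure.map_congr this, Measure.map_id]

lemma map_pr_le_iff (d : ℕ) (μ ν : Measure (Fin d → ℝ)) (hμ : ∀ᵐ x ∂μ, x ∈ Qd d)
    (hν : ∀ᵐ x ∂ν, x ∈ Qd d) : μ.map (pr d) ≤ ν.map (pr d) ↔ μ ≤ ν := by
  refine ⟨fun h => ?_, fun h => Measure.map_mono h (measurable_pr d)⟩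
  rw [← map_sec_pr d μ hμ, ← map_sec_pr d ν hν]
  exact Measure.map_mono h (measurable_sec d)

lemma ae_bounds_iff (d : ℕ) (D : Set (Fin d → ℝ)) (hD : MeasurableSet D) (A B : ℝ) :
    (∀ᵐ x ∂(volume.restrict (unitCube d)),
          ENNReal.ofReal A ≤ Phi d D x ∧ Phi d D x ≤ ENNReal.ofReal B) ↔
    (ENNReal.ofReal A • (volume.restrict (Qd d)).map (pr d) ≤ (volume.restrict D).map (pr d) ∧
    (volume.restrict D).map (pr d) ≤ ENNReal.ofReal B • (volume.restrict (Qd d)).map (pr d)) := by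
  have hq : ∀ᵐ x ∂(volume.restrict (Qd d)), x ∈ Qd d := ae_restrict_mem (measurableSet_Qd d)
  have h1 : ∀ c : ℝ≥0∞, ∀ᵐ x ∂(c • volume.restrict (Qd d)), x ∈ Qd d := fun c =>
    Measure.ae_smul_measure hq c
  have h2 : ∀ᵐ x ∂((volume.restrict (Qd d)).withDensity (Phi d D)), x ∈ Qd d :=
    (withDensity_absolutelyContinuous _ _).ae_le hq
  rw [restrict_unitCube, map_D d D hD, ← Measure.map_smul, ← Measure.map_smul,
    map_pr_le_iff _ _ _ (h1 _) h2, map_pr_le_iff _ _ _ h2 (h1 _), ← withDensity_const,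
    ← withDensity_const, Filter.eventually_and]
  refine and_congr ⟨fun h => withDensity_mono h, fun h => ?_⟩
    ⟨fun h => withDensity_mono h, fun h => ?_⟩
  · refine ae_le_of_forall_setLIntegral_le_of_sigmaFinite measurable_const fun s hs _ => ?_
    rw [← withDensity_apply _ hs, ← withDensity_apply _ hs]
    exact h s
  · refine ae_le_of_forall_setLIntegral_le_of_sigmaFinite (measurable_Phi d D hD) fun s hs _ => ?_
    rw [← withDensity_apply _ hs, ← withDensity_apply _ hs]
    exact h s

/-! ### Trigonometric polynomials -/

def tp (d : ℕ) (a : (Fin d → ℤ) →₀ ℂ) : C(UnitAddTorus (Fin d), ℂ) :=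
  Finsupp.linearCombination ℂ (UnitAddTorus.mFourier (d := Fin d)) a

lemma mFourier_pr (d : ℕ) (n : Fin d → ℤ) (x : Fin d → ℝ) :
    UnitAddTorus.mFourier n (pr d x) = fExp d n x := by
  simp only [UnitAddTorus.mFourier, ContinuousMap.coe_mk, pr, fExp, fourier_coe_apply]
  rw [← Complex.exp_sum]
  congr 1
  push_cast
  rw [Finset.mul_sum]
  refine Finset.sum_congr rfl fun i _ => ?_
  simp; ring

lemma tp_pr (d : ℕ) (a : (Fin d → ℤ) →₀ ℂ) (x : Fin d → ℝ) :
    tp d a (pr d x) = ∑ n ∈ a.support, a n * fExp d n x := by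
  simp only [tp, Finsupp.linearCombination_apply, Finsupp.sum, ContinuousMap.coe_sum,
    Finset.sum_apply, ContinuousMap.coe_smul, Pi.smul_apply, mFourier_pr, smul_eq_mul]

lemma dense_tp (d : ℕ) : DenseRange (tp d) := by
  have h := UnitAddTorus.span_mFourier_closure_eq_top (d := Fin d)
  rw [← Finsupp.range_linearCombination] at h
  exact (Submodule.dense_iff_topologicalClosure_eq_top.2 h)

lemma continuous_sq_integral (d : ℕ) (μ : Measure (UnitAddTorus (Fin d))) [IsFiniteMeasure μ] :
    Continuous fun f : C(UnitAddTorus (Fin d), ℂ) => ∫ t, ‖f t‖ ^ 2 ∂μ := by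
  rw [continuous_iff_continuousAt]
  intro f₀
  refine continuousAt_of_dominated (bound := fun _ => (‖f₀‖ + 1) ^ 2) ?_ ?_
    (integrable_const _) ?_
  · exact Filter.Eventually.of_forall fun f =>
      (by fun_prop : Continuous fun t => ‖f t‖ ^ 2).aestronglyMeasurable
  · filter_upwards [Metric.ball_mem_nhds f₀ one_pos] with f hf
    refine Filter.Eventually.of_forall fun t => ?_
    rw [norm_pow, norm_norm]
    have h1 : ‖f t‖ ≤ ‖f‖ := f.norm_coe_le_norm t
    have h2 : ‖f - f₀‖ < 1 := by simpa [dist_eq_norm] using hf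
    have h3 : ‖f‖ ≤ ‖f₀‖ + ‖f - f₀‖ := norm_le_norm_add_norm_sub' f f₀
    gcongr
    linarith
  · refine Filter.Eventually.of_forall fun t => ?_
    exact ((continuous_eval_const t).norm.pow 2).continuousAt

lemma sq_integrable (d : ℕ) (μ : Measure (UnitAddTorus (Fin d))) [IsFiniteMeasure μ]
    (f : C(UnitAddTorus (Fin d), ℂ)) : Integrable (fun t => ‖f t‖ ^ 2) μ :=
  (by fun_prop : Continuous fun t => ‖f t‖ ^ 2).integrable_of_hasCompactSupport
    (HasCompactSupport.of_compactSpace _)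

lemma measure_le_iff (d : ℕ) (μ ν : Measure (UnitAddTorus (Fin d))) [IsFiniteMeasure μ]
    [IsFiniteMeasure ν] :
    μ ≤ ν ↔ ∀ a, ∫ t, ‖tp d a t‖ ^ 2 ∂μ ≤ ∫ t, ‖tp d a t‖ ^ 2 ∂ν := by
  constructor
  · intro h a
    exact integral_mono_measure h (Filter.Eventually.of_forall fun t => by positivity)
      (sq_integrable d ν _)
  intro h
  have hall : ∀ f : C(UnitAddTorus (Fin d), ℂ), ∫ t, ‖f t‖ ^ 2 ∂μ ≤ ∫ t, ‖f t‖ ^ 2 ∂ν := by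
    intro f
    refine (dense_tp d).induction_on (p := fun f : C(UnitAddTorus (Fin d), ℂ) =>
      ∫ t, ‖f t‖ ^ 2 ∂μ ≤ ∫ t, ‖f t‖ ^ 2 ∂ν) f ?_ h
    exact isClosed_le (continuous_sq_integral d μ) (continuous_sq_integral d ν)
  have hc : ∀ F : Set (UnitAddTorus (Fin d)), IsClosed F → μ F ≤ ν F := by
    intro F hF
    refine le_of_tendsto_of_tendsto' (HasOuterApproxClosed.tendsto_lintegral_apprSeq hF μ)
      (HasOuterApproxClosed.tendsto_lintegral_apprSeq hF ν) fun n => ?_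
    let g := hF.apprSeq n
    let f : C(UnitAddTorus (Fin d), ℂ) :=
      ⟨fun t => ((Real.sqrt (g t) : ℝ) : ℂ), by fun_prop⟩
    have hf : ∀ t, ENNReal.ofReal (‖f t‖ ^ 2) = (g t : ℝ≥0∞) := by
      intro t
      simp only [f, ContinuousMap.coe_mk, Complex.norm_real, Real.norm_eq_abs, sq_abs]
      rw [Real.sq_sqrt (NNReal.coe_nonneg _), ENNReal.ofReal_coe_nnreal]
    have key : ∀ ρ : Measure (UnitAddTorus (Fin d)), ∀ [IsFiniteMeasure ρ],
        ∫⁻ t, (g t : ℝ≥0∞) ∂ρ = ENNReal.ofReal (∫ t, ‖f t‖ ^ 2 ∂ρ) := by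
      intro ρ _
      rw [ofReal_integral_eq_lintegral_ofReal (sq_integrable d ρ f)
        (Filter.Eventually.of_forall fun t => by positivity)]
      simp_rw [hf]
    change ∫⁻ t, (g t : ℝ≥0∞) ∂μ ≤ ∫⁻ t, (g t : ℝ≥0∞) ∂ν
    rw [key μ, key ν]
    exact ENNReal.ofReal_le_ofReal (hall f)
  refine Measure.le_iff.2 fun s hs => ?_
  rw [hs.measure_eq_iSup_isClosed_of_ne_top (measure_ne_top μ s)]
  exact iSup_le fun K => iSup_le fun hK => iSup_le fun hKc => (hc K hKc).trans (measure_mono hK)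

/-! ### Orthogonality -/

lemma integral_one_dim (k : ℤ) :
    ∫ x in Ioc (-(1/2) : ℝ) (1/2), Complex.exp (2 * Real.pi * Complex.I * k * x)
      = if k = 0 then 1 else 0 := by
  rw [← intervalIntegral.integral_of_le (by norm_num)]
  split_ifs with hk
  · subst hk; norm_num
  · have hk' : (k : ℂ) ≠ 0 := by exact_mod_cast hk
    rw [integral_exp_mul_complex (by simp [hk', Real.pi_ne_zero])]
    have : Complex.exp (2 * Real.pi * Complex.I * k * ((1/2 : ℝ) : ℂ)) =
        Complex.exp (2 * Real.pi * Complex.I * k * ((-(1/2) : ℝ) : ℂ)) := by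
      rw [Complex.exp_eq_exp_iff_exists_int]
      exact ⟨k, by push_cast; ring⟩
    rw [this]; simp

lemma integral_fExp (d : ℕ) (n : Fin d → ℤ) :
    ∫ x in Qd d, fExp d n x = if n = 0 then 1 else 0 := by
  have h : ∀ x, fExp d n x = ∏ i, Complex.exp (2 * Real.pi * Complex.I * n i * x i) := by
    intro x
    rw [fExp, ← Complex.exp_sum]
    congr 1
    push_cast
    rw [Finset.mul_sum]
    exact Finset.sum_congr rfl fun i _ => by ring
  simp_rw [h]
  rw [Qd, volume_pi, Measure.restrict_pi_pi,
    integral_fintype_prod_eq_prod (fun i (y : ℝ) => Complex.exp (2 * Real.pi * Complex.I * n i * y))]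
  simp_rw [integral_one_dim]
  split_ifs with h0
  · simp [h0]
  · obtain ⟨i, hi⟩ := Function.ne_iff.1 h0
    exact Finset.prod_eq_zero (Finset.mem_univ i) (by simpa using hi)

lemma fExp_mul_conj (d : ℕ) (m n : Fin d → ℤ) (x : Fin d → ℝ) :
    fExp d m x * (starRingEnd ℂ) (fExp d n x) = fExp d (m - n) x := by
  rw [← mFourier_pr, ← mFourier_pr, ← mFourier_pr, ← UnitAddTorus.mFourier_neg,
    ← UnitAddTorus.mFourier_add, sub_eq_add_neg]

lemma continuous_fExp (d : ℕ) (n : Fin d → ℤ) : Continuous (fExp d n) := by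
  unfold fExp; fun_prop

lemma norm_fExp (d : ℕ) (n : Fin d → ℤ) (x : Fin d → ℝ) : ‖fExp d n x‖ = 1 := by
  rw [fExp, show (2 * Real.pi * Complex.I * ((∑ i, (n i : ℝ) * x i : ℝ) : ℂ) : ℂ) =
    ((2 * Real.pi * ∑ i, (n i : ℝ) * x i : ℝ) : ℂ) * Complex.I by push_cast; ring]
  exact Complex.norm_exp_ofReal_mul_I _

lemma parseval (d : ℕ) (a : (Fin d → ℤ) →₀ ℂ) :
    ∫ x in Qd d, ‖∑ n ∈ a.support, a n * fExp d n x‖ ^ 2 = ∑ n ∈ a.support, ‖a n‖ ^ 2 := by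
  have hint : ∀ c : ℂ, ∀ n, Integrable (fun x => c * fExp d n x) (volume.restrict (Qd d)) := by
    intro c n
    refine Integrable.const_mul ?_ c
    exact Integrable.of_bound (continuous_fExp d n).aestronglyMeasurable 1
      (Filter.Eventually.of_forall fun x => (norm_fExp d n x).le)
  rw [← Complex.ofReal_inj, ← integral_complex_ofReal]
  have h : ∀ x, ((‖∑ n ∈ a.support, a n * fExp d n x‖ ^ 2 : ℝ) : ℂ) =
      ∑ m ∈ a.support, ∑ n ∈ a.support, (a m * (starRingEnd ℂ) (a n)) * fExp d (m - n) x := by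
    intro x
    push_cast
    rw [← Complex.mul_conj', map_sum, Finset.sum_mul_sum]
    refine Finset.sum_congr rfl fun m _ => Finset.sum_congr rfl fun n _ => ?_
    rw [map_mul, ← fExp_mul_conj]; ring
  simp_rw [h]
  rw [integral_finset_sum _ fun m _ => integrable_finset_sum _ fun n _ => hint _ _]
  push_cast
  refine Finset.sum_congr rfl fun m hm => ?_
  rw [integral_finset_sum _ fun n _ => hint _ _]
  simp_rw [integral_const_mul, integral_fExp, sub_eq_zero]
  simp only [mul_ite, mul_one, mul_zero, Finset.sum_ite_eq, hm, if_true]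
  exact Complex.mul_conj' _

lemma integral_tp (d : ℕ) (a : (Fin d → ℤ) →₀ ℂ) (S : Set (Fin d → ℝ)) :
    ∫ t, ‖tp d a t‖ ^ 2 ∂((volume.restrict S).map (pr d)) =
      ∫ x in S, ‖∑ n ∈ a.support, a n * fExp d n x‖ ^ 2 := by
  rw [integral_map (measurable_pr d).aemeasurable
    (by fun_prop : Continuous fun t => ‖tp d a t‖ ^ 2).aestronglyMeasurable]
  simp_rw [tp_pr]

lemma riesz_iff (d : ℕ) (D : Set (Fin d → ℝ)) (hfin : volume D < ⊤) (A B : ℝ)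
    (hA : 0 ≤ A) (hB : 0 ≤ B) :
    RieszSeq d D A B ↔
    (ENNReal.ofReal A • (volume.restrict (Qd d)).map (pr d) ≤ (volume.restrict D).map (pr d) ∧
    (volume.restrict D).map (pr d) ≤ ENNReal.ofReal B • (volume.restrict (Qd d)).map (pr d)) := by
  haveI : IsFiniteMeasure (volume.restrict D) := ⟨by simpa using hfin⟩
  haveI : ∀ c : ℝ, IsFiniteMeasure (ENNReal.ofReal c • (volume.restrict (Qd d)).map (pr d)) :=
    fun c => Measure.smul_finite _ ENNReal.ofReal_ne_top
  rw [measure_le_iff, measure_le_iff, ← forall_and, RieszSeq]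
  refine forall_congr' fun a => ?_
  rw [integral_smul_measure, integral_smul_measure, integral_tp, integral_tp, parseval,
    ENNReal.toReal_ofReal hA, ENNReal.toReal_ofReal hB, smul_eq_mul, smul_eq_mul]

theorem stmt1 (d : ℕ) (D : Set (Fin d → ℝ)) (hD : MeasurableSet D)
    (hfin : volume D < ⊤) :
    (∃ A B : ℝ, 0 < A ∧ A ≤ B ∧ RieszSeq d D A B) ↔
      (∃ A B : ℝ, 0 < A ∧ A ≤ B ∧
        ∀ᵐ x ∂(volume.restrict (unitCube d)),
          ENNReal.ofReal A ≤ Phi d D x ∧ Phi d D x ≤ ENNReal.ofReal B) := by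
  refine exists_congr fun A => exists_congr fun B => and_congr_right fun hA =>
    and_congr_right fun hAB => ?_
  rw [riesz_iff d D hfin A B hA.le (hA.le.trans hAB), ae_bounds_iff d D hD A B]
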